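/- arXiv:2504.06711 — 3 statements merged into one kernel-verified Lean document; each statement's English description precedes it below -/
import Mathlib

section
/- Let α ≥ 0 and 2 ≤ k ≤ n. There exists a constant θ > 0, depending only on n and k, such that for every λ = (λ_1,…,λ_n) ∈ Γ̃_k with λ_1 ≥ λ_2 ≥ ⋯ ≥ λ_n and every index i with 1 ≤ i ≤ k−1 (so that λ_i > 0), one has S_k^{ii}(λ) = S_{k−1}(λ|i) ≥ θ·S_k(λ)/λ_i. -/
open Finset

/-- The `j`-th elementary symmetric polynomial of `lam` restricted to the index set `A`,
with `σ_0 = 1` and `σ_j = 0` for `j < 0` or `j > |A|`. -/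
noncomputable def esigma {n : ℕ} (A : Finset (Fin n)) (j : ℤ) (lam : Fin n → ℝ) : ℝ :=
  if 0 ≤ j then ∑ s ∈ A.powersetCard j.toNat, ∏ i ∈ s, lam i else 0

/-- The sum Hessian operator `S_j(λ) = σ_{j-1}(λ) + α σ_j(λ)` on the index set `A`. -/
noncomputable def Ssum {n : ℕ} (α : ℝ) (A : Finset (Fin n)) (j : ℤ) (lam : Fin n → ℝ) : ℝ :=
  esigma A (j - 1) lam + α * esigma A j lam

/-- The Gårding cone `Γ_k`. -/
def Gamma (n k : ℕ) : Set (Fin n → ℝ) :=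
  {lam | ∀ j : ℕ, 1 ≤ j → j ≤ k → 0 < esigma Finset.univ (j : ℤ) lam}

/-- The admissible cone `Γ̃_k = Γ_{k-1} ∩ {S_k > 0}`. -/
def GammaTilde (n k : ℕ) (α : ℝ) : Set (Fin n → ℝ) :=
  Gamma n (k - 1) ∩ {lam | 0 < Ssum α Finset.univ (k : ℤ) lam}

open Polynomial in
/-- The derivative of a real-rooted polynomial is real-rooted. -/
theorem Polynomial.Splits.derivative_real {p : ℝ[X]} (hp : p.Splits) :
    (derivative p).Splits := by
  rcases Nat.eq_zero_or_pos p.natDegree with h0 | hpos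
  · rw [natDegree_eq_zero.mp h0 |>.choose_spec.symm]
    simp
  · rw [splits_iff_card_roots] at hp ⊢
    have h1 := card_roots_le_derivative p
    have h2 := card_roots' (derivative p)
    have h3 := natDegree_derivative_lt hpos.ne'
    omega

open Polynomial in
/-- Iterated derivatives of a real-rooted polynomial are real-rooted. -/
theorem Polynomial.Splits.iterate_derivative_real {p : ℝ[X]} (hp : p.Splits) (m : ℕ) :
    (derivative^[m] p).Splits := by
  induction m with
  | zero => exact hp
  | succ m ih =>
    rw [Function.iterate_succ_apply']
    exact ih.derivative_real

open Polynomial in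
/-- Laguerre's inequality at the origin for real-rooted polynomials. -/
theorem Polynomial.Splits.two_mul_coeff_zero_mul_coeff_two_le {p : ℝ[X]} (hp : p.Splits) :
    2 * (p.coeff 0 * p.coeff 2) ≤ p.coeff 1 ^ 2 := by
  have key : ∀ s : Multiset ℝ, 2 * ((s.map fun r => X - C r).prod.coeff 0 *
      (s.map fun r => X - C r).prod.coeff 2) ≤ (s.map fun r => X - C r).prod.coeff 1 ^ 2 := by
    intro s
    induction s using Multiset.induction with
    | empty => simp [coeff_one]
    | cons r s ih =>
      rw [Multiset.map_cons, Multiset.prod_cons]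
      set q := (s.map fun r => X - C r).prod
      simp only [sub_mul, coeff_sub, coeff_C_mul, coeff_X_mul_zero, coeff_X_mul]
      nlinarith [mul_nonneg (sq_nonneg r) (sub_nonneg.mpr ih), sq_nonneg (q.coeff 0)]
  rw [hp.eq_prod_roots]
  simp only [coeff_C_mul]
  nlinarith [mul_le_mul_of_nonneg_left (key p.roots) (sq_nonneg p.leadingCoeff)]

open Polynomial in
/-- A weak form of Newton's inequality for the coefficients of a real-rooted polynomial. -/
theorem Polynomial.Splits.coeff_mul_coeff_le_sq {p : ℝ[X]} (hp : p.Splits) (m : ℕ) :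
    p.coeff m * p.coeff (m + 2) ≤ p.coeff (m + 1) ^ 2 := by
  have h := (hp.iterate_derivative_real m).two_mul_coeff_zero_mul_coeff_two_le
  simp only [coeff_iterate_derivative, nsmul_eq_mul, zero_add] at h
  have e0 : m.descFactorial m = m.factorial := Nat.descFactorial_self m
  have e1 : (1 + m).descFactorial m = (m + 1) * m.factorial := by
    have := Nat.factorial_mul_descFactorial (show m ≤ 1 + m by omega)
    rw [show 1 + m - m = 1 by omega, add_comm 1 m] at this
    rw [add_comm 1 m]
    simpa [Nat.factorial_succ] using this
  have e2 : 2 * (2 + m).descFactorial m = (m + 2) * ((m + 1) * m.factorial) := by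
    have := Nat.factorial_mul_descFactorial (show m ≤ 2 + m by omega)
    rw [show 2 + m - m = 2 by omega, add_comm 2 m] at this
    rw [add_comm 2 m]
    simpa [Nat.factorial_succ] using this
  have e2' : (2 : ℝ) * ((2 + m).descFactorial m : ℝ) = (m + 2) * ((m + 1) * m.factorial) := by
    exact_mod_cast e2
  rw [e0, e1, add_comm 1 m, add_comm 2 m] at h
  rw [add_comm 2 m] at e2'
  push_cast at h
  have hf : (0 : ℝ) < m.factorial := by exact_mod_cast m.factorial_pos
  have hc : (0 : ℝ) < (m + 1) * (m.factorial : ℝ) ^ 2 := by positivity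
  have h' : ((m + 1) * (m.factorial : ℝ) ^ 2) * ((m + 2) * (p.coeff m * p.coeff (m + 2))) ≤
      ((m + 1) * (m.factorial : ℝ) ^ 2) * ((m + 1) * p.coeff (m + 1) ^ 2) := by
    calc _ = (m.factorial : ℝ) * p.coeff m *
            (((m + 2) * ((m + 1) * m.factorial)) * p.coeff (m + 2)) := by ring
      _ = 2 * (m.factorial * p.coeff m * (((m + 2).descFactorial m) * p.coeff (m + 2))) := by
            rw [← e2']; ring
      _ ≤ _ := h
      _ = _ := by ring
  have h'' := le_of_mul_le_mul_left h' hc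
  rcases le_total (p.coeff m * p.coeff (m + 2)) 0 with hn | hn
  · exact hn.trans (sq_nonneg _)
  · have hm : (0 : ℝ) < m + 1 := by positivity
    refine le_of_mul_le_mul_left ?_ hm
    linarith

namespace Multiset

theorem esymm_zero_right (s : Multiset ℝ) : s.esymm 0 = 1 := by
  simp [esymm]

theorem esymm_cons_succ (x : ℝ) (s : Multiset ℝ) (k : ℕ) :
    (x ::ₘ s).esymm (k + 1) = s.esymm (k + 1) + x * s.esymm k := by
  simp [esymm, powersetCard_cons, sum_map_mul_left]

/-- A weak form of Newton's inequality for elementary symmetric functions. -/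
theorem esymm_mul_esymm_le_sq (s : Multiset ℝ) (k : ℕ) :
    s.esymm k * s.esymm (k + 2) ≤ s.esymm (k + 1) ^ 2 := by
  rcases le_or_gt (k + 2) (card s) with h | h
  · have hs : (s.map fun r => Polynomial.X + Polynomial.C r).prod.Splits := by
      refine Polynomial.Splits.multisetProd fun q hq => ?_
      obtain ⟨r, -, rfl⟩ := mem_map.mp hq
      exact Polynomial.Splits.X_add_C r
    have := hs.coeff_mul_coeff_le_sq (card s - (k + 2))
    rw [prod_X_add_C_coeff s (by omega), prod_X_add_C_coeff s (by omega),
      prod_X_add_C_coeff s (by omega), show card s - (card s - (k + 2)) = k + 2 by omega,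
      show card s - (card s - (k + 2) + 2) = k by omega,
      show card s - (card s - (k + 2) + 1) = k + 1 by omega] at this
    linarith
  · have : s.esymm (k + 2) = 0 := by simp [esymm, powersetCard_eq_empty _ h]
    rw [this, mul_zero]
    exact sq_nonneg _

/-- The Gårding cone for multisets: the first `k` elementary symmetric functions are positive. -/
def InGarding (s : Multiset ℝ) (k : ℕ) : Prop := ∀ j ≤ k, 0 < s.esymm j

theorem InGarding.mono {s : Multiset ℝ} {k l : ℕ} (h : s.InGarding k) (hl : l ≤ k) :
    s.InGarding l := fun j hj => h j (hj.trans hl)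

theorem InGarding.succ {s : Multiset ℝ} {k : ℕ} (h : s.InGarding k) (hpos : 0 < s.esymm (k + 1)) :
    s.InGarding (k + 1) := fun j hj => by
  rcases Nat.le_succ_iff.mp hj with hj | rfl
  exacts [h j hj, hpos]

/-- Deleting an entry lowers the order of the Gårding cone by at most one. -/
theorem InGarding.of_cons {x : ℝ} {s : Multiset ℝ} {k : ℕ} (h : (x ::ₘ s).InGarding (k + 1)) :
    s.InGarding k := by
  induction k with
  | zero =>
    intro j hj
    rw [Nat.le_zero.mp hj, esymm_zero_right]
    exact one_pos
  | succ k ih =>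
    have hk := ih (h.mono (by omega))
    refine hk.succ ?_
    by_contra! hb
    have ha := hk k le_rfl
    have h1 := h (k + 1) (by omega)
    have h2 := h (k + 2) (by omega)
    rw [esymm_cons_succ] at h1 h2
    have hN := s.esymm_mul_esymm_le_sq k
    nlinarith [mul_pos ha h2, mul_nonneg (neg_nonneg.mpr hb) h1.le]

/-- If at most `k` entries of an element of the cone of order `k + 1` exceed `t ≥ 0`, then
`σ_{k+1} ≤ N t σ_k`, where `N` is the number of entries. -/
theorem InGarding.esymm_succ_le {s : Multiset ℝ} {k : ℕ} {t : ℝ} (h : s.InGarding (k + 1))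
    (ht : 0 ≤ t) (hc : s.countP (t < ·) ≤ k) :
    s.esymm (k + 1) ≤ card s * t * s.esymm k := by
  induction hN : card s generalizing s k with
  | zero =>
    rw [card_eq_zero.mp hN]
    simp [esymm, powersetCard_zero_right]
  | succ N ih =>
    obtain ⟨x, hx, hmax⟩ : ∃ x ∈ s, ∀ y ∈ s, y ≤ x := by
      have hne : s.toFinset.Nonempty := by
        rw [toFinset_nonempty]
        rintro rfl
        simp at hN
      obtain ⟨x, hx, hm⟩ := s.toFinset.exists_max_image id hne
      exact ⟨x, mem_toFinset.mp hx, fun y hy => hm y (mem_toFinset.mpr hy)⟩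
    obtain ⟨r, rfl⟩ := exists_cons_of_mem hx
    have hr : r.InGarding k := h.of_cons
    have hN' : card r = N := by simpa using hN
    have hek := hr k le_rfl
    have hcr : r.countP (t < ·) ≤ k := le_trans (by rw [countP_cons]; omega) hc
    have hlast : r.esymm (k + 1) ≤ N * t * r.esymm k := by
      rcases le_or_gt (r.esymm (k + 1)) 0 with h0 | h0
      · exact h0.trans (by positivity)
      · exact ih (hr.succ h0) hcr hN'
    rw [esymm_cons_succ]
    push_cast
    cases k with
    | zero =>
      have hxt : x ≤ t := by
        have := countP_eq_zero.mp (Nat.le_zero.mp hc) x (mem_cons_self x r)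
        exact not_lt.mp this
      simp only [esymm_zero_right] at *
      linarith
    | succ k =>
      have hek' := hr k (by omega)
      rw [esymm_cons_succ x r k]
      rcases le_or_gt x t with hxt | hxt
      · have hx0 : 0 ≤ x := by
          by_contra! hx0
          have h1 := h 1 (by omega)
          rw [esymm, powersetCard_one, map_map] at h1
          simp only [Function.comp_def, prod_singleton, map_id'] at h1
          have : (x ::ₘ r).sum ≤ 0 := by
            simpa using sum_le_card_nsmul (x ::ₘ r) 0 fun y hy => (hmax y hy).trans hx0.le
          linarith
        have : 0 ≤ (N + 1) * t * (x * r.esymm k) := by positivity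
        nlinarith [mul_le_mul_of_nonneg_right hxt hek.le]
      · have hck : r.countP (t < ·) ≤ k := by
          rw [countP_cons_of_pos _ hxt] at hc
          exact Nat.le_of_succ_le_succ hc
        have hx0 : 0 ≤ x := ht.trans hxt.le
        have h1 := mul_le_mul_of_nonneg_left (ih hr hck hN') hx0
        have h2 : 0 ≤ t * (r.esymm (k + 1) + x * r.esymm k) := by positivity
        nlinarith

/-- If at most `k` of the other entries exceed the entry `x` of an element of the cone of order
`k + 1`, then `x > 0` and `x σ_k(·|x)` controls `σ_{k+1}`. -/
theorem InGarding.esymm_succ_cons_le {x : ℝ} {s : Multiset ℝ} {k : ℕ}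
    (h : (x ::ₘ s).InGarding (k + 1)) (hc : s.countP (x < ·) ≤ k) :
    0 < x ∧ (x ::ₘ s).esymm (k + 1) ≤ (card s + 1) * x * s.esymm k := by
  have hs := h.of_cons
  have hek := hs k le_rfl
  have hx : 0 < x := by
    by_contra! hx
    have hc0 : (x ::ₘ s).countP (0 < ·) ≤ k := by
      rw [countP_cons_of_neg _ hx.not_gt]
      refine le_trans ?_ hc
      rw [countP_eq_card_filter, countP_eq_card_filter]
      exact card_le_card (monotone_filter_right s fun y hy => hx.trans_lt hy)
    have := h.esymm_succ_le le_rfl hc0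
    have := h (k + 1) le_rfl
    linarith
  refine ⟨hx, ?_⟩
  have hlast : s.esymm (k + 1) ≤ card s * x * s.esymm k := by
    rcases le_or_gt (s.esymm (k + 1)) 0 with h0 | h0
    · exact h0.trans (by positivity)
    · exact (hs.succ h0).esymm_succ_le hx.le hc
  rw [esymm_cons_succ]
  linarith

end Multiset

theorem esigma_natCast {n : ℕ} (A : Finset (Fin n)) (j : ℕ) (lam : Fin n → ℝ) :
    esigma A (j : ℤ) lam = (A.val.map lam).esymm j := by
  simp [esigma, Finset.esymm_map_val]

theorem Ssum_natCast_succ {n : ℕ} (α : ℝ) (A : Finset (Fin n)) (j : ℕ) (lam : Fin n → ℝ) :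
    Ssum α A ((j + 1 : ℕ) : ℤ) lam =
      (A.val.map lam).esymm j + α * (A.val.map lam).esymm (j + 1) := by
  rw [Ssum, esigma_natCast, ← esigma_natCast A j]
  simp

/-- Lemma 2.3 (ii): there is `θ = θ(n,k) > 0` such that for every `α ≥ 0`,
every ordered `λ ∈ Γ̃_k` and every `1 ≤ i ≤ k-1`, `S_k^{ii}(λ) = S_{k-1}(λ|i) ≥ θ S_k(λ)/λ_i`. -/
theorem Skii_lower_bound {n k : ℕ} (hk2 : 2 ≤ k) (hkn : k ≤ n) :
    ∃ θ : ℝ, 0 < θ ∧ ∀ (α : ℝ), 0 ≤ α →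
      ∀ lam : Fin n → ℝ, lam ∈ GammaTilde n k α → Antitone lam →
        ∀ i : Fin n, (i : ℕ) + 1 ≤ k - 1 →
          Ssum α (Finset.univ \ {i}) ((k : ℤ) - 1) lam
            ≥ θ * Ssum α Finset.univ (k : ℤ) lam / lam i := by
  refine ⟨1 / (n + 1), by positivity, fun α hα lam hlam hanti i hi => ?_⟩
  obtain ⟨K, rfl⟩ : ∃ K, k = K + 2 := ⟨k - 2, by omega⟩
  obtain ⟨hG, hS⟩ := hlam
  set s : Multiset ℝ := (Finset.univ \ {i}).val.map lam with hs_def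
  have hfull : (Finset.univ : Finset (Fin n)).val.map lam = lam i ::ₘ s := by
    rw [hs_def, ← Multiset.map_cons, ← Finset.insert_val_of_notMem (by simp)]
    congr 2
    ext j
    simp
  have hcard : Multiset.card s + 1 = n := by
    simpa using (congrArg Multiset.card hfull).symm
  have hcount : s.countP (lam i < ·) ≤ K := by
    rw [hs_def, Multiset.countP_map]
    have hsub : (Finset.univ \ {i}).filter (fun j => lam i < lam j) ⊆ Finset.Iio i := by
      intro j hj
      rw [Finset.mem_Iio]
      by_contra! hij
      exact ((Finset.mem_filter.mp hj).2).not_ge (hanti hij)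
    have := Finset.card_le_card hsub
    rw [Fin.card_Iio] at this
    exact le_trans this (by omega)
  have hG' : (lam i ::ₘ s).InGarding (K + 1) := by
    intro j hj
    rcases Nat.eq_zero_or_pos j with rfl | hj0
    · rw [Multiset.esymm_zero_right]
      exact one_pos
    · have := hG j hj0 (by omega)
      rwa [esigma_natCast, hfull] at this
  have hS' : 0 < Ssum α Finset.univ ((K + 2 : ℕ) : ℤ) lam := hS
  rw [show ((K + 2 : ℕ) : ℤ) - 1 = ((K + 1 : ℕ) : ℤ) by push_cast; ring, Ssum_natCast_succ]
  rw [Ssum_natCast_succ, hfull] at hS' ⊢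
  have hx : 0 < lam i := (hG'.esymm_succ_cons_le hcount).1
  rw [ge_iff_le, div_le_iff₀ hx, one_div, inv_mul_le_iff₀ (by positivity), ← hs_def]
  have hcardR : (Multiset.card s : ℝ) + 1 = n := by exact_mod_cast hcard
  rcases hα.eq_or_lt with rfl | hα
  · have h1 := (hG'.esymm_succ_cons_le hcount).2
    have h2 := (hG'.of_cons) K le_rfl
    rw [hcardR] at h1
    have : 0 < s.esymm K * lam i := mul_pos h2 hx
    linarith
  · have hext (u : Multiset ℝ) (j : ℕ) :
        u.esymm j + α * u.esymm (j + 1) = α * (α⁻¹ ::ₘ u).esymm (j + 1) := by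
      rw [Multiset.esymm_cons_succ]
      field_simp
      ring
    have hT : (lam i ::ₘ α⁻¹ ::ₘ s).InGarding (K + 1 + 1) := by
      rw [Multiset.cons_swap]
      refine Multiset.InGarding.succ (fun j hj => ?_) ?_
      · cases j with
        | zero => rw [Multiset.esymm_zero_right]; exact one_pos
        | succ j =>
          rw [Multiset.esymm_cons_succ]
          exact add_pos (hG' _ hj) (mul_pos (inv_pos.mpr hα) (hG' _ (by omega)))
      · rw [hext] at hS'
        exact pos_of_mul_pos_right hS' hα.le
    have hcT : (α⁻¹ ::ₘ s).countP (lam i < ·) ≤ K + 1 := by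
      rw [Multiset.countP_cons]
      split_ifs <;> omega
    have h1 := (hT.esymm_succ_cons_le hcT).2
    rw [Multiset.card_cons, hcard] at h1
    rw [hext, hext, Multiset.cons_swap]
    nlinarith [mul_le_mul_of_nonneg_left h1 hα.le]
end

section
/- Let n ≥ 3, let α be a constant, and let λ = (λ_1,…,λ_n) ∈ ℝ^n. Then for all distinct indices p, q with p ≠ 1 and q ≠ 1, the following algebraic identity holds: λ_1·(S_n^{pp}(λ)·S_n^{11,qq}(λ) + S_n^{qq}(λ)·S_n^{11,pp}(λ) − S_n^{11}(λ)·S_n^{pp,qq}(λ)) − S_n^{pp}(λ)·S_n^{qq}(λ) = λ_1²·σ_{n−3}(λ|1pq)² − S_n(λ)·σ_{n−3}(λ|1pq), where S_n^{ii}(λ) = S_{n−1}(λ|i), S_n^{11,ii}(λ) = S_{n−2}(λ|1i), S_n^{pp,qq}(λ) = S_{n−2}(λ|pq), and (λ|1pq) is λ with the entries indexed 1, p, q deleted. -/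
open Finset

/-- Pascal-type recursion: `σ_j(A ∪ {a}) = σ_j(A) + λ_a σ_{j-1}(A)`. -/
lemma esigma_insert {n : ℕ} {A : Finset (Fin n)} {a : Fin n} (ha : a ∉ A) (j : ℤ)
    (lam : Fin n → ℝ) :
    esigma (insert a A) j lam = esigma A j lam + lam a * esigma A (j - 1) lam := by
  rcases lt_trichotomy j 0 with hj | rfl | hj
  · simp [esigma, not_le.mpr hj, show ¬ 1 ≤ j by omega]
  · simp [esigma]
  · obtain ⟨k, rfl⟩ : ∃ k : ℕ, j = k + 1 := ⟨(j - 1).toNat, by omega⟩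
    have hk : ((k : ℤ) + 1).toNat = k + 1 := by omega
    have hmem : ∀ s ∈ A.powersetCard k, a ∉ s := fun s hs h =>
      ha ((mem_powersetCard.mp hs).1 h)
    rw [esigma, esigma, esigma, if_pos hj.le, if_pos hj.le, if_pos (by omega), hk,
      add_sub_cancel_right, Int.toNat_natCast, powersetCard_succ_insert ha, sum_union, sum_image,
      mul_sum]
    · congr 1
      exact sum_congr rfl fun s hs => prod_insert (hmem s hs)
    · intro s hs t ht hst
      rw [← erase_insert (hmem s hs), hst, erase_insert (hmem t ht)]
    · rw [disjoint_left]
      intro s hs hs'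
      obtain ⟨t, -, rfl⟩ := mem_image.mp hs'
      exact ha ((mem_powersetCard.mp hs).1 (mem_insert_self a t))

/-- `σ_j(A) = 0` for `j > |A|`. -/
lemma esigma_eq_zero_of_card_lt {n : ℕ} {A : Finset (Fin n)} {j : ℤ} (h : (#A : ℤ) < j)
    (lam : Fin n → ℝ) : esigma A j lam = 0 := by
  rw [esigma, if_pos (by omega), powersetCard_eq_empty.mpr (by omega), sum_empty]

/-- Lemma 3.1 (ii): the algebraic identity
`λ_1 (S_n^{pp} S_n^{11,qq} + S_n^{qq} S_n^{11,pp} - S_n^{11} S_n^{pp,qq}) - S_n^{pp} S_n^{qq}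
  = λ_1² σ_{n-3}(λ|1pq)² - S_n σ_{n-3}(λ|1pq)`. -/
theorem Sn_identity_ii {n : ℕ} (hn : 3 ≤ n) (α : ℝ) (lam : Fin n → ℝ)
    (p q : Fin n) (hpq : p ≠ q) (hp : p ≠ ⟨0, by omega⟩) (hq : q ≠ ⟨0, by omega⟩) :
    lam ⟨0, by omega⟩
        * (Ssum α (Finset.univ \ {p}) ((n : ℤ) - 1) lam
              * Ssum α (Finset.univ \ {(⟨0, by omega⟩ : Fin n), q}) ((n : ℤ) - 2) lam
            + Ssum α (Finset.univ \ {q}) ((n : ℤ) - 1) lam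
              * Ssum α (Finset.univ \ {(⟨0, by omega⟩ : Fin n), p}) ((n : ℤ) - 2) lam
            - Ssum α (Finset.univ \ {(⟨0, by omega⟩ : Fin n)}) ((n : ℤ) - 1) lam
              * Ssum α (Finset.univ \ {p, q}) ((n : ℤ) - 2) lam)
      - Ssum α (Finset.univ \ {p}) ((n : ℤ) - 1) lam
          * Ssum α (Finset.univ \ {q}) ((n : ℤ) - 1) lam
    = (lam ⟨0, by omega⟩) ^ 2
          * (esigma (Finset.univ \ {(⟨0, by omega⟩ : Fin n), p, q}) ((n : ℤ) - 3) lam) ^ 2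
      - Ssum α Finset.univ (n : ℤ) lam
          * esigma (Finset.univ \ {(⟨0, by omega⟩ : Fin n), p, q}) ((n : ℤ) - 3) lam := by
  generalize hz : (⟨0, by omega⟩ : Fin n) = z at *
  set B : Finset (Fin n) := univ \ {z, p, q} with hB
  have hzB : z ∉ B := by simp [hB]
  have hpB : p ∉ B := by simp [hB]
  have hqB : q ∉ B := by simp [hB]
  have hcard : (#B : ℤ) = n - 3 := by
    have h3 : #({z, p, q} : Finset (Fin n)) = 3 := card_eq_three.mpr
      ⟨z, p, q, hp.symm, hq.symm, hpq, rfl⟩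
    rw [hB, card_sdiff_of_subset (subset_univ _), h3, card_univ, Fintype.card_fin]
    omega
  have e_zq : univ \ {z, q} = insert p B := by ext i; simp [hB]; grind
  have e_zp : univ \ {z, p} = insert q B := by ext i; simp [hB]; grind
  have e_pq : univ \ {p, q} = insert z B := by ext i; simp [hB]; grind
  have e_p : univ \ {p} = insert z (insert q B) := by ext i; simp [hB]; grind
  have e_q : univ \ {q} = insert z (insert p B) := by ext i; simp [hB]; grind
  have e_z : univ \ {z} = insert p (insert q B) := by ext i; simp [hB]; grind
  have e_univ : (univ : Finset (Fin n)) = insert z (insert p (insert q B)) := by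
    ext i; simp [hB]; grind
  have hp_q : p ∉ insert q B := by simp [hpq, hpB]
  have hzq : z ∉ insert q B := by simp [hq.symm, hzB]
  have hzp : z ∉ insert p B := by simp [hp.symm, hzB]
  have hzpq : z ∉ insert p (insert q B) := by simp [hp.symm, hq.symm, hzB]
  have v0 : esigma B (n : ℤ) lam = 0 := esigma_eq_zero_of_card_lt (by omega) lam
  have v1 : esigma B ((n : ℤ) - 1) lam = 0 := esigma_eq_zero_of_card_lt (by omega) lam
  have v2 : esigma B ((n : ℤ) - 2) lam = 0 := esigma_eq_zero_of_card_lt (by omega) lam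
  rw [e_zq, e_zp, e_pq, e_p, e_q, e_z, e_univ]
  simp only [Ssum, esigma_insert hzpq, esigma_insert hzq, esigma_insert hzp, esigma_insert hp_q,
    esigma_insert hzB, esigma_insert hpB, esigma_insert hqB, sub_sub]
  norm_num only [v0, v1, v2]
  ring
end

section
/- Let n ≥ 3 and α ≥ 0. For every λ = (λ_1,…,λ_n) ∈ Γ̃_n with λ_1 ≥ λ_2 ≥ ⋯ ≥ λ_n and every ε > 0, there exists a constant K > 0 (depending on ε, n, α and λ) such that for every ξ = (ξ_1,…,ξ_n) ∈ ℝ^n, λ_1·( K·(Σ_j S_n^{jj}(λ)·ξ_j)² − Σ_{p≠q} S_n^{pp,qq}(λ)·ξ_p·ξ_q ) − S_n^{11}(λ)·ξ_1² + (1+ε)·Σ_{j>1} S_n^{jj}(λ)·ξ_j² ≥ 0, where S_n^{jj}(λ) = S_{n−1}(λ|j) and, for p ≠ q, S_n^{pp,qq}(λ) = S_{n−2}(λ|pq). -/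
open Finset

section

/-- The quotient of the quadratic form by the product of the middle entries is nonnegative, once
the sums over the middle entries are replaced by the scalars `U, V, N, M, H`. -/
lemma reduced_form_nonneg {L l t w p x η U V N M H ε κ k : ℝ} (hL : 0 < L) (ht : 0 < t)
    (hw : w = l * t + 1) (hw0 : 0 < w) (hp : p = L * w + l) (hp0 : 0 < p)
    (hVH : V ^ 2 ≤ t * H) (hUM : U ^ 2 ≤ t * M) (hlog : 0 ≤ V ^ 2 + t ^ 2 * N - 2 * t * H)
    (hε : 0 < ε) (hκ : 0 < κ)
    (hb : (l * U + η) ^ 2 ≤ κ * ((L * t + 1) * η ^ 2 + p * M - L * l * N))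
    (hk : k = 1 / w + κ / (w ^ 2 * ε)) :
    0 ≤ k * (w * x + (L * t + 1) * η + p * U - L * l * V) ^ 2
      - L * (2 * x * η * t + 2 * x * (l * (t * U - V) + U) + 2 * η * (L * (t * U - V) + U)
          + L * l * (t * U ^ 2 - 2 * U * V + 2 * H - t * N) + (L + l) * (U ^ 2 - N))
      - w * x ^ 2 + (1 + ε) * ((L * t + 1) * η ^ 2 + p * M - L * l * N) := by
  set Q := (L * t + 1) * η ^ 2 + p * M - L * l * N with hQ
  set s := w * x + (L * t + 1) * η + p * U - L * l * V with hs
  set b := l * U + η with hbdef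
  have hident : - L * (2 * x * η * t + 2 * x * (l * (t * U - V) + U)
          + 2 * η * (L * (t * U - V) + U)
          + L * l * (t * U ^ 2 - 2 * U * V + 2 * H - t * N) + (L + l) * (U ^ 2 - N))
      - w * x ^ 2 + Q =
      L ^ 2 / w * ((η * t + V / t) ^ 2
        + w / t ^ 2 * (w * (V ^ 2 + t ^ 2 * N - 2 * t * H) + 2 * (t * H - V ^ 2)))
      + p / w * (t * (η - U / t) ^ 2 + w * (M - U ^ 2 / t)) + 2 * b * s / w - s ^ 2 / w := by
    have hl : l = (w - 1) / t := by rw [hw]; field_simp; ring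
    rw [hQ, hs, hbdef, hp, hl]
    field_simp
    ring
  have hI : 0 ≤ L ^ 2 / w * ((η * t + V / t) ^ 2
        + w / t ^ 2 * (w * (V ^ 2 + t ^ 2 * N - 2 * t * H) + 2 * (t * H - V ^ 2))) := by
    have : 0 ≤ t * H - V ^ 2 := by linarith
    positivity
  have hE : 0 ≤ p / w * (t * (η - U / t) ^ 2 + w * (M - U ^ 2 / t)) := by
    have : 0 ≤ M - U ^ 2 / t := by
      rw [sub_nonneg, div_le_iff₀ ht]; linarith
    positivity
  have hcross : 0 ≤ ε * Q + 2 * b * s / w + κ / (w ^ 2 * ε) * s ^ 2 := by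
    have h1 : ε / κ * b ^ 2 ≤ ε * Q := by
      rw [div_mul_eq_mul_div, div_le_iff₀ hκ]
      nlinarith
    have h2 : ε / κ * b ^ 2 + 2 * b * s / w + κ / (w ^ 2 * ε) * s ^ 2
        = ε / κ * (b + κ * s / (ε * w)) ^ 2 := by
      field_simp
      ring
    have h3 : 0 ≤ ε / κ * (b + κ * s / (ε * w)) ^ 2 := by positivity
    linarith
  have hks : k * s ^ 2 = s ^ 2 / w + κ / (w ^ 2 * ε) * s ^ 2 := by rw [hk]; ring
  linarith

lemma add_sq_le_of_sq_le_mul {g k W U l η : ℝ} (hg : 0 < g) (hk : 0 ≤ k) (hW : 0 ≤ W)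
    (hU : U ^ 2 ≤ k * W) :
    (l * U + η) ^ 2 ≤ (2 / g + 2 * l ^ 2 * k) * (g * η ^ 2 + W) := by
  have hexp : (2 / g + 2 * l ^ 2 * k) * (g * η ^ 2 + W)
      = 2 * η ^ 2 + 2 / g * W + 2 * l ^ 2 * k * (g * η ^ 2) + 2 * l ^ 2 * (k * W) := by
    field_simp
    ring
  have h1 : 0 ≤ 2 / g * W := by positivity
  have h2 : 0 ≤ 2 * l ^ 2 * k * (g * η ^ 2) := by positivity
  have h3 := mul_le_mul_of_nonneg_left hU (by positivity : 0 ≤ 2 * l ^ 2)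
  nlinarith [sq_nonneg (l * U - η)]

variable {ι : Type*} [DecidableEq ι]

lemma sum_sum_erase_insert (F : ι → ι → ℝ) (hF : ∀ p q, F p q = F q p) {a : ι} {A : Finset ι}
    (ha : a ∉ A) :
    ∑ p ∈ insert a A, ∑ q ∈ (insert a A).erase p, F p q
      = 2 * ∑ q ∈ A, F a q + ∑ p ∈ A, ∑ q ∈ A.erase p, F p q := by
  have h : ∑ p ∈ A, ∑ q ∈ (insert a A).erase p, F p q
      = ∑ p ∈ A, (F a p + ∑ q ∈ A.erase p, F p q) := by
    refine Finset.sum_congr rfl fun p hp => ?_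
    have hne : a ≠ p := fun h => ha (h ▸ hp)
    rw [Finset.erase_insert_of_ne hne,
      Finset.sum_insert (fun h => ha (Finset.mem_of_mem_erase h)), hF p a]
  rw [Finset.sum_insert ha, Finset.erase_insert ha, h, Finset.sum_add_distrib]
  ring

/-- Log-concavity of `∏ μ_i (α + ∑ 1 / μ_i)`, written in the variables `r_i = 1 / μ_i`. -/
lemma sq_sum_add_nonneg (A : Finset ι) (r z : ι → ℝ) (hr : ∀ i ∈ A, 0 < r i) {t : ℝ}
    (ht : ∑ i ∈ A, r i ≤ t) :
    0 ≤ (∑ i ∈ A, r i * z i) ^ 2 + t ^ 2 * ∑ i ∈ A, z i ^ 2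
      - 2 * t * ∑ i ∈ A, r i * z i ^ 2 := by
  have hsplit : (∑ i ∈ A, r i * z i) ^ 2 = ∑ p ∈ A, (r p * z p) ^ 2
      + ∑ p ∈ A, ∑ q ∈ A.erase p, (r p * z p) * (r q * z q) := by
    rw [sq, Finset.sum_mul_sum, ← Finset.sum_add_distrib]
    refine Finset.sum_congr rfl fun p hp => ?_
    rw [← Finset.add_sum_erase A _ hp]
    ring
  have hswap : ∑ p ∈ A, ∑ q ∈ A.erase p, (r p * z q) ^ 2
      = ∑ p ∈ A, ∑ q ∈ A.erase p, (r q * z p) ^ 2 := by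
    refine Finset.sum_comm' fun p q => ?_
    simp only [Finset.mem_erase]
    tauto
  have hcross : - ∑ p ∈ A, ∑ q ∈ A.erase p, (r q * z p) ^ 2
      ≤ ∑ p ∈ A, ∑ q ∈ A.erase p, (r p * z p) * (r q * z q) := by
    have h : 0 ≤ ∑ p ∈ A, ∑ q ∈ A.erase p, (r q * z p + r p * z q) ^ 2 :=
      Finset.sum_nonneg fun p _ => Finset.sum_nonneg fun q _ => sq_nonneg _
    have h' : ∑ p ∈ A, ∑ q ∈ A.erase p, (r q * z p + r p * z q) ^ 2
        = ∑ p ∈ A, ∑ q ∈ A.erase p, (r q * z p) ^ 2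
          + ∑ p ∈ A, ∑ q ∈ A.erase p, (r p * z q) ^ 2
          + 2 * ∑ p ∈ A, ∑ q ∈ A.erase p, (r p * z p) * (r q * z q) := by
      simp only [Finset.mul_sum, ← Finset.sum_add_distrib]
      exact Finset.sum_congr rfl fun p _ => Finset.sum_congr rfl fun q _ => by ring
    linarith
  have hdiag : ∑ p ∈ A, ∑ q ∈ A.erase p, (r q * z p) ^ 2 ≤ ∑ p ∈ A, (t - r p) ^ 2 * z p ^ 2 := by
    refine Finset.sum_le_sum fun p hp => ?_
    simp only [mul_pow, ← Finset.sum_mul]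
    refine mul_le_mul_of_nonneg_right ?_ (sq_nonneg _)
    have hnn : ∀ q ∈ A.erase p, 0 ≤ r q := fun q hq => (hr q (Finset.mem_of_mem_erase hq)).le
    have h1 : ∑ q ∈ A.erase p, r q ^ 2 ≤ (∑ q ∈ A.erase p, r q) ^ 2 :=
      Finset.sum_sq_le_sq_sum_of_nonneg hnn
    have h2 : ∑ q ∈ A.erase p, r q ≤ t - r p := by
      rw [← Finset.add_sum_erase A _ hp] at ht
      linarith
    exact h1.trans (pow_le_pow_left₀ (Finset.sum_nonneg hnn) h2 2)
  have hexp : ∑ p ∈ A, (t - r p) ^ 2 * z p ^ 2 = t ^ 2 * ∑ i ∈ A, z i ^ 2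
      - 2 * t * ∑ i ∈ A, r i * z i ^ 2 + ∑ p ∈ A, (r p * z p) ^ 2 := by
    simp only [Finset.mul_sum, ← Finset.sum_add_distrib, ← Finset.sum_sub_distrib]
    exact Finset.sum_congr rfl fun p _ => by ring
  linarith

lemma sum_sum_erase_bilinear (A : Finset ι) (r z : ι → ℝ) (c d t : ℝ) :
    ∑ p ∈ A, ∑ q ∈ A.erase p, (c * (t - r p - r q) + d) * (z p * z q)
      = c * (t * (∑ i ∈ A, z i) ^ 2 - 2 * (∑ i ∈ A, z i) * (∑ i ∈ A, r i * z i)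
          + 2 * (∑ i ∈ A, r i * z i ^ 2) - t * ∑ i ∈ A, z i ^ 2)
        + d * ((∑ i ∈ A, z i) ^ 2 - ∑ i ∈ A, z i ^ 2) := by
  have h : ∀ p ∈ A, ∑ q ∈ A.erase p, (c * (t - r p - r q) + d) * (z p * z q)
      = (c * t + d) * (∑ i ∈ A, z i) * z p - c * (∑ i ∈ A, z i) * (r p * z p)
        - c * (∑ i ∈ A, r i * z i) * z p
        - (c * t + d) * z p ^ 2 + 2 * c * (r p * z p ^ 2) := by
    intro p hp
    have h1 : ∑ q ∈ A, (c * (t - r p - r q) + d) * (z p * z q)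
        = (c * (t - r p) + d) * z p * (∑ i ∈ A, z i) - c * z p * (∑ i ∈ A, r i * z i) := by
      simp only [Finset.mul_sum, ← Finset.sum_sub_distrib]
      exact Finset.sum_congr rfl fun q _ => by ring
    rw [← Finset.add_sum_erase A _ hp] at h1
    linear_combination h1
  rw [Finset.sum_congr rfl h]
  simp only [Finset.sum_add_distrib, Finset.sum_sub_distrib, ← Finset.mul_sum]
  ring

variable {n : ℕ}

lemma esigma_card (A : Finset (Fin n)) (lam : Fin n → ℝ) :
    esigma A (A.card : ℤ) lam = ∏ i ∈ A, lam i := by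
  simp [esigma]

lemma esigma_card_sub_one (A : Finset (Fin n)) (lam : Fin n → ℝ) :
    esigma A ((A.card : ℤ) - 1) lam = ∑ i ∈ A, ∏ k ∈ A.erase i, lam k := by
  rcases A.eq_empty_or_nonempty with rfl | hA
  · simp [esigma]
  have hpos := hA.card_pos
  have hnat : ((A.card : ℤ) - 1).toNat = A.card - 1 := by omega
  rw [esigma, if_pos (by omega), hnat]
  have himg : A.powersetCard (A.card - 1) = A.image (fun i => A.erase i) := by
    ext s
    simp only [Finset.mem_powersetCard, Finset.mem_image]
    constructor
    · rintro ⟨hs, hc⟩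
      have h1 : (A \ s).card = 1 := by rw [Finset.card_sdiff_of_subset hs]; omega
      obtain ⟨i, hi⟩ := Finset.card_eq_one.mp h1
      refine ⟨i, ?_, ?_⟩
      · exact (Finset.mem_sdiff.mp (hi ▸ Finset.mem_singleton_self i : i ∈ A \ s)).1
      · rw [← Finset.sdiff_singleton_eq_erase, ← hi, Finset.sdiff_sdiff_eq_self hs]
    · rintro ⟨i, hi, rfl⟩
      exact ⟨Finset.erase_subset _ _, Finset.card_erase_of_mem hi⟩
  rw [himg, Finset.sum_image fun i hi j hj h => ?_]
  by_contra hij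
  have : i ∈ A.erase j := Finset.mem_erase.mpr ⟨hij, hi⟩
  rw [← show A.erase i = A.erase j from h] at this
  exact Finset.notMem_erase i A this

lemma Ssum_card (α : ℝ) (A : Finset (Fin n)) (lam : Fin n → ℝ) :
    Ssum α A (A.card : ℤ) lam
      = ∑ i ∈ A, ∏ k ∈ A.erase i, lam k + α * ∏ i ∈ A, lam i := by
  rw [Ssum, esigma_card, esigma_card_sub_one]

lemma Ssum_insert (α : ℝ) {A : Finset (Fin n)} {a : Fin n} (ha : a ∉ A) (lam : Fin n → ℝ) :
    Ssum α (insert a A) ((insert a A).card : ℤ) lam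
      = lam a * Ssum α A (A.card : ℤ) lam + ∏ i ∈ A, lam i := by
  have h : ∑ i ∈ A, ∏ k ∈ (insert a A).erase i, lam k
      = lam a * ∑ i ∈ A, ∏ k ∈ A.erase i, lam k := by
    rw [Finset.mul_sum]
    refine Finset.sum_congr rfl fun i hi => ?_
    have hne : a ≠ i := fun h => ha (h ▸ hi)
    rw [Finset.erase_insert_of_ne hne,
      Finset.prod_insert fun h => ha (Finset.mem_of_mem_erase h)]
  rw [Ssum_card, Ssum_card, Finset.sum_insert ha, Finset.erase_insert ha, h,
    Finset.prod_insert ha]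
  ring

lemma prod_erase_eq (A : Finset (Fin n)) (lam : Fin n → ℝ) (h0 : ∀ i ∈ A, lam i ≠ 0)
    {i : Fin n} (hi : i ∈ A) :
    ∏ k ∈ A.erase i, lam k = (∏ k ∈ A, lam k) * (lam i)⁻¹ := by
  rw [← Finset.mul_prod_erase A _ hi]
  field_simp [h0 i hi]

lemma Ssum_card_of_ne_zero (α : ℝ) (A : Finset (Fin n)) (lam : Fin n → ℝ)
    (h0 : ∀ i ∈ A, lam i ≠ 0) :
    Ssum α A (A.card : ℤ) lam = (∏ i ∈ A, lam i) * (α + ∑ i ∈ A, (lam i)⁻¹) := by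
  rw [Ssum_card, Finset.sum_congr rfl fun i hi => prod_erase_eq A lam h0 hi, ← Finset.mul_sum]
  ring

/-- On the cone `Γ_{n-1}` every shift by a nonnegative constant has positive `σ_{n-1}`. -/
lemma sum_prod_erase_add_pos {lam : Fin n → ℝ} (hn : 1 ≤ n) (hlam : lam ∈ Gamma n (n - 1))
    {t : ℝ} (ht : 0 ≤ t) :
    0 < ∑ i : Fin n, ∏ k ∈ Finset.univ.erase i, (t + lam k) := by
  set f : Polynomial ℝ := ∏ i : Fin n, (Polynomial.X + Polynomial.C (lam i)) with hf
  have hcoeff : ∀ k, 1 ≤ k → k ≤ n → 0 < f.coeff k := by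
    intro k hk hkn
    rw [hf, Finset.prod_X_add_C_coeff _ _ (by simpa using hkn)]
    rcases eq_or_lt_of_le hkn with rfl | hlt
    · simp
    · have := hlam (n - k) (by omega) (by omega)
      simpa [esigma] using this
  have hdeg : f.natDegree = n := by
    rw [hf, Polynomial.natDegree_prod_of_monic _ _ fun i _ => Polynomial.monic_X_add_C _]
    simp
  have heval : f.derivative.eval t = ∑ i : Fin n, ∏ k ∈ Finset.univ.erase i, (t + lam k) := by
    rw [hf, Polynomial.derivative_prod_finset, Polynomial.eval_finsetSum]
    simp [Polynomial.eval_prod]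
  rw [← heval, Polynomial.eval_eq_sum_range' (n := n) (by
    have := Polynomial.natDegree_derivative_lt (p := f) (by omega)
    omega)]
  refine Finset.sum_pos' (fun k hk => ?_) ⟨0, by simp; omega, ?_⟩
  · rw [Polynomial.coeff_derivative]
    have := hcoeff (k + 1) (by omega) (by simpa [Nat.succ_le_iff] using hk)
    positivity
  · rw [Polynomial.coeff_derivative]
    have := hcoeff 1 le_rfl hn
    simpa using this

lemma pos_of_lt_last {lam : Fin n → ℝ} (hlam : lam ∈ Gamma n (n - 1)) (hord : Antitone lam)
    {i : Fin n} (hi : i.val + 1 < n) : 0 < lam i := by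
  set j : Fin n := ⟨n - 2, by omega⟩ with hj
  set l : Fin n := ⟨n - 1, by omega⟩ with hl
  have hjl : j < l := by simp only [hj, hl, Fin.mk_lt_mk]; omega
  have hij : i ≤ j := by simp only [hj, Fin.le_def]; omega
  suffices h : 0 < lam j from h.trans_le (hord hij)
  by_contra! hneg
  have hpos := sum_prod_erase_add_pos (by omega) hlam (t := -lam j) (by linarith)
  rw [Finset.sum_eq_single j (fun k _ hk => Finset.prod_eq_zero
      (Finset.mem_erase.mpr ⟨hk.symm, Finset.mem_univ j⟩) (by ring)) (by simp),
    ← Finset.mul_prod_erase _ _ (Finset.mem_erase.mpr ⟨hjl.ne', Finset.mem_univ l⟩)] at hpos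
  refine absurd hpos (not_lt.mpr (mul_nonpos_of_nonpos_of_nonneg ?_ (Finset.prod_nonneg ?_)))
  · linarith [hord hjl.le]
  · intro k hk
    simp only [Finset.mem_erase, Finset.mem_univ, ne_eq, Fin.ext_iff, hj, hl] at hk
    have hkj : k ≤ j := by simp only [hj, Fin.le_def]; omega
    linarith [hord hkj]

lemma Ssum_insert_of_ne_zero (α : ℝ) {A : Finset (Fin n)} {a : Fin n} (ha : a ∉ A)
    (lam : Fin n → ℝ) (h0 : ∀ i ∈ A, lam i ≠ 0) {j : ℤ} (hj : j = A.card + 1) :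
    Ssum α (insert a A) j lam
      = (∏ i ∈ A, lam i) * (lam a * (α + ∑ i ∈ A, (lam i)⁻¹) + 1) := by
  have hj' : j = ((insert a A).card : ℤ) := by rw [Finset.card_insert_of_notMem ha, hj]; simp
  rw [hj', Ssum_insert α ha, Ssum_card_of_ne_zero α A lam h0]
  ring

lemma Ssum_insert_insert_of_ne_zero (α : ℝ) {A : Finset (Fin n)} {a l : Fin n} (hal : a ≠ l)
    (ha : a ∉ A) (hl : l ∉ A) (lam : Fin n → ℝ) (h0 : ∀ i ∈ A, lam i ≠ 0) {j : ℤ}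
    (hj : j = A.card + 2) :
    Ssum α (insert a (insert l A)) j lam
      = (∏ i ∈ A, lam i)
        * (lam a * lam l * (α + ∑ i ∈ A, (lam i)⁻¹) + lam a + lam l) := by
  have ha' : a ∉ insert l A := by simp [hal, ha]
  have hj' : j = ((insert a (insert l A)).card : ℤ) := by
    rw [Finset.card_insert_of_notMem ha', Finset.card_insert_of_notMem hl, hj]
    push_cast
    ring
  rw [hj', Ssum_insert α ha', Ssum_insert_of_ne_zero α hl lam h0 (by
    rw [Finset.card_insert_of_notMem hl]; simp), Finset.prod_insert hl]
  ring

set_option maxHeartbeats 1000000 in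
/-- The concavity inequality for two distinguished indices `a`, `l` when all the other entries,
those indexed by `M`, are positive. -/
lemma concavity_inequality_of_pos (α : ℝ) (hα : 0 ≤ α) (lam : Fin n → ℝ) {a l : Fin n}
    {M : Finset (Fin n)} (hal : a ≠ l) (haM : a ∉ M) (hlM : l ∉ M)
    (huniv : (Finset.univ : Finset (Fin n)) = insert a (insert l M)) (hM : M.Nonempty)
    (hpos : ∀ i ∈ M, 0 < lam i) (ha : 0 < lam a)
    (hS : 0 < Ssum α Finset.univ (n : ℤ) lam) (ε : ℝ) (hε : 0 < ε) :
    ∃ K : ℝ, 0 < K ∧ ∀ ξ : Fin n → ℝ,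
      lam a * (K * (∑ j : Fin n, Ssum α (Finset.univ \ {j}) ((n : ℤ) - 1) lam * ξ j) ^ 2
              - ∑ p : Fin n, ∑ q ∈ Finset.univ.erase p,
                  Ssum α (Finset.univ \ {p, q}) ((n : ℤ) - 2) lam * ξ p * ξ q)
        - Ssum α (Finset.univ \ {a}) ((n : ℤ) - 1) lam * (ξ a) ^ 2
        + (1 + ε) * ∑ j ∈ Finset.univ.erase a,
            Ssum α (Finset.univ \ {j}) ((n : ℤ) - 1) lam * ξ j ^ 2
      ≥ 0 := by
  have h0 : ∀ i ∈ M, lam i ≠ 0 := fun i hi => (hpos i hi).ne'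
  have haM' : a ∉ insert l M := by simp [hal, haM]
  have hcard : (n : ℤ) = M.card + 2 := by
    have h := congrArg Finset.card huniv
    rw [Finset.card_univ, Fintype.card_fin, Finset.card_insert_of_notMem haM',
      Finset.card_insert_of_notMem hlM] at h
    omega
  obtain ⟨r, hr⟩ : ∃ r : Fin n → ℝ, r = fun i => (lam i)⁻¹ := ⟨_, rfl⟩
  have hrlam : ∀ i ∈ M, lam i * r i = 1 := fun i hi => by
    rw [hr]; exact mul_inv_cancel₀ (h0 i hi)
  have hrpos : ∀ i ∈ M, 0 < r i := fun i hi => by rw [hr]; exact inv_pos.mpr (hpos i hi)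
  obtain ⟨C, hC⟩ : ∃ C, C = ∏ i ∈ M, lam i := ⟨_, rfl⟩
  obtain ⟨t, ht⟩ : ∃ t, t = α + ∑ i ∈ M, r i := ⟨_, rfl⟩
  have hC0 : 0 < C := hC ▸ Finset.prod_pos hpos
  have hRt : ∑ i ∈ M, r i ≤ t := by linarith
  have ht0 : 0 < t := (Finset.sum_pos hrpos hM).trans_le hRt
  have hrt : ∀ i ∈ M, r i ≤ t := fun i hi =>
    (Finset.single_le_sum (fun k hk => (hrpos k hk).le) hi).trans hRt
  obtain ⟨w, hw⟩ : ∃ w, w = lam l * t + 1 := ⟨_, rfl⟩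
  obtain ⟨p, hp⟩ : ∃ p, p = lam a * w + lam l := ⟨_, rfl⟩
  -- The products and reciprocal sums after deleting one or two middle entries.
  have hprod1 : ∀ i ∈ M, ∏ k ∈ M.erase i, lam k = C * r i := fun i hi => by
    rw [hC, hr, prod_erase_eq M lam h0 hi]
  have hsum1 : ∀ i ∈ M, α + ∑ k ∈ M.erase i, (lam k)⁻¹ = t - r i := fun i hi => by
    rw [ht, hr, ← Finset.add_sum_erase M _ hi]; ring
  have h01 : ∀ i, ∀ k ∈ M.erase i, lam k ≠ 0 := fun i k hk => h0 k (Finset.mem_of_mem_erase hk)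
  have hcard1 : ∀ i ∈ M, ((M.erase i).card : ℤ) = M.card - 1 := fun i hi => by
    have := Finset.card_erase_add_one hi
    omega
  -- The first derivatives.
  have hSa : Ssum α (Finset.univ \ {a}) ((n : ℤ) - 1) lam = C * w := by
    have hset : Finset.univ \ {a} = insert l M := by
      rw [huniv, Finset.sdiff_singleton_eq_erase, Finset.erase_insert haM']
    rw [hset, Ssum_insert_of_ne_zero α hlM lam h0 (by omega), hw, hC, ht, hr]
  have hSl : Ssum α (Finset.univ \ {l}) ((n : ℤ) - 1) lam = C * (lam a * t + 1) := by
    have hset : Finset.univ \ {l} = insert a M := by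
      rw [huniv, Finset.sdiff_singleton_eq_erase, Finset.erase_insert_of_ne hal,
        Finset.erase_insert hlM]
    rw [hset, Ssum_insert_of_ne_zero α haM lam h0 (by omega), hC, ht, hr]
  have hSi : ∀ i ∈ M, Ssum α (Finset.univ \ {i}) ((n : ℤ) - 1) lam
      = C * r i * (p - lam a * lam l * r i) := fun i hi => by
    have hai : a ≠ i := fun h => haM (h ▸ hi)
    have hli : l ≠ i := fun h => hlM (h ▸ hi)
    have hset : Finset.univ \ {i} = insert a (insert l (M.erase i)) := by
      rw [huniv, Finset.sdiff_singleton_eq_erase, Finset.erase_insert_of_ne hai,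
        Finset.erase_insert_of_ne hli]
    rw [hset, Ssum_insert_insert_of_ne_zero α hal (by simp [haM]) (by simp [hlM]) lam (h01 i)
      (by rw [hcard1 i hi]; omega), hprod1 i hi, hsum1 i hi, hp, hw]
    ring
  have hSuniv : Ssum α Finset.univ (n : ℤ) lam = C * p := by
    rw [huniv, Ssum_insert_insert_of_ne_zero α hal haM hlM lam h0 hcard, hp, hw, hC, ht, hr]
    ring
  have hp0 : 0 < p := by
    rw [hSuniv] at hS
    exact (mul_pos_iff_of_pos_left hC0).mp hS
  have hw0 : 0 < w := by
    rcases le_or_gt 0 (lam l) with hl | hl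
    · rw [hw]; positivity
    · exact (mul_pos_iff_of_pos_left ha).mp (by linarith)
  have hci : ∀ i ∈ M, 0 < p * lam i - lam a * lam l := fun i hi => by
    have hi0 := hpos i hi
    rcases lt_or_ge 0 (lam l) with hl | hl
    · have h1 : 1 ≤ t * lam i := by
        nlinarith [hrt i hi, hrlam i hi]
      have h2 : p * lam i - lam a * lam l
          = lam a * lam l * (t * lam i - 1) + (lam a + lam l) * lam i := by
        rw [hp, hw]; ring
      rw [h2]
      have : 0 ≤ t * lam i - 1 := by linarith
      positivity
    · have := mul_pos hp0 hi0
      have := mul_nonpos_of_nonneg_of_nonpos ha.le hl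
      linarith
  -- The second derivatives.
  have hSal : Ssum α (Finset.univ \ {a, l}) ((n : ℤ) - 2) lam = C * t := by
    have hset : Finset.univ \ {a, l} = M := by
      rw [huniv]; ext k; simp only [mem_sdiff, mem_insert, mem_singleton]
      constructor
      · tauto
      · exact fun hk => ⟨by tauto, by rintro (rfl | rfl) <;> contradiction⟩
    rw [hset, show (n : ℤ) - 2 = M.card by omega, Ssum_card_of_ne_zero α M lam h0, hC, ht, hr]
  have hSai : ∀ i ∈ M, Ssum α (Finset.univ \ {a, i}) ((n : ℤ) - 2) lam
      = C * r i * (lam l * (t - r i) + 1) := fun i hi => by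
    have hli : l ≠ i := fun h => hlM (h ▸ hi)
    have hset : Finset.univ \ {a, i} = insert l (M.erase i) := by
      rw [Finset.sdiff_insert, Finset.sdiff_singleton_eq_erase, huniv,
        Finset.erase_right_comm, Finset.erase_insert haM', Finset.erase_insert_of_ne hli]
    rw [hset, Ssum_insert_of_ne_zero α (by simp [hlM]) lam (h01 i)
      (by rw [hcard1 i hi]; omega), hprod1 i hi, hsum1 i hi]
  have hSli : ∀ i ∈ M, Ssum α (Finset.univ \ {l, i}) ((n : ℤ) - 2) lam
      = C * r i * (lam a * (t - r i) + 1) := fun i hi => by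
    have hai : a ≠ i := fun h => haM (h ▸ hi)
    have hset : Finset.univ \ {l, i} = insert a (M.erase i) := by
      rw [Finset.sdiff_insert, Finset.sdiff_singleton_eq_erase, huniv,
        Finset.erase_right_comm, Finset.erase_insert_of_ne hal, Finset.erase_insert hlM,
        Finset.erase_insert_of_ne hai]
    rw [hset, Ssum_insert_of_ne_zero α (by simp [haM]) lam (h01 i)
      (by rw [hcard1 i hi]; omega), hprod1 i hi, hsum1 i hi]
  have hSij : ∀ i ∈ M, ∀ j ∈ M.erase i, Ssum α (Finset.univ \ {i, j}) ((n : ℤ) - 2) lam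
      = C * (r i * r j)
        * (lam a * lam l * (t - r i - r j) + (lam a + lam l)) := fun i hi j hj => by
    have hjM := Finset.mem_of_mem_erase hj
    have hai : a ≠ i := fun h => haM (h ▸ hi)
    have hli : l ≠ i := fun h => hlM (h ▸ hi)
    have haj : a ≠ j := fun h => haM (h ▸ hjM)
    have hlj : l ≠ j := fun h => hlM (h ▸ hjM)
    have hset : Finset.univ \ {i, j} = insert a (insert l ((M.erase i).erase j)) := by
      rw [Finset.sdiff_insert, Finset.sdiff_singleton_eq_erase, huniv,
        Finset.erase_right_comm, Finset.erase_insert_of_ne hai, Finset.erase_insert_of_ne hli,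
        Finset.erase_insert_of_ne haj, Finset.erase_insert_of_ne hlj]
    have hcard2 := Finset.card_erase_add_one hj
    have hsum2 : α + ∑ k ∈ (M.erase i).erase j, (lam k)⁻¹ = t - r i - r j := by
      rw [← hsum1 i hi, hr, ← Finset.add_sum_erase (M.erase i) _ hj]; ring
    have hprod2 : ∏ k ∈ (M.erase i).erase j, lam k = C * (r i * r j) := by
      rw [prod_erase_eq _ lam (h01 i) hj, hprod1 i hi, hr]; ring
    rw [hset, Ssum_insert_insert_of_ne_zero α hal (by simp [haM]) (by simp [hlM]) lam
      (fun k hk => h01 i k (Finset.mem_of_mem_erase hk))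
      (by have := hcard1 i hi; omega), hprod2, hsum2]
    ring
  obtain ⟨κ, hκ⟩ : ∃ κ, κ = 2 / (lam a * t + 1)
      + 2 * lam l ^ 2 * ∑ i ∈ M, (p * lam i - lam a * lam l)⁻¹ := ⟨_, rfl⟩
  have hinv : 0 ≤ ∑ i ∈ M, (p * lam i - lam a * lam l)⁻¹ :=
    Finset.sum_nonneg fun i hi => (inv_pos.mpr (hci i hi)).le
  have hat : 0 < lam a * t + 1 := by positivity
  have hκ0 : 0 < κ := by rw [hκ]; positivity
  obtain ⟨k, hk⟩ : ∃ k, k = 1 / w + κ / (w ^ 2 * ε) := ⟨_, rfl⟩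
  have hk0 : 0 < k := by rw [hk]; positivity
  refine ⟨k / (lam a * C), by positivity, fun ξ => ?_⟩
  obtain ⟨z, hz⟩ : ∃ z : Fin n → ℝ, z = fun i => r i * ξ i := ⟨_, rfl⟩
  have hzξ : ∀ i ∈ M, ξ i = lam i * z i := fun i hi => by
    rw [hz]; linear_combination (-ξ i) * hrlam i hi
  have hzi : ∀ i, z i = r i * ξ i := fun i => by rw [hz]
  obtain ⟨U, hU⟩ : ∃ U, U = ∑ i ∈ M, z i := ⟨_, rfl⟩
  obtain ⟨V, hV⟩ : ∃ V, V = ∑ i ∈ M, r i * z i := ⟨_, rfl⟩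
  obtain ⟨N, hN⟩ : ∃ N, N = ∑ i ∈ M, z i ^ 2 := ⟨_, rfl⟩
  obtain ⟨T, hT⟩ : ∃ T, T = ∑ i ∈ M, lam i * z i ^ 2 := ⟨_, rfl⟩
  obtain ⟨H, hH⟩ : ∃ H, H = ∑ i ∈ M, r i * z i ^ 2 := ⟨_, rfl⟩
  have hgrad : ∑ j : Fin n, Ssum α (Finset.univ \ {j}) ((n : ℤ) - 1) lam * ξ j
      = C * (w * ξ a + (lam a * t + 1) * ξ l + p * U - lam a * lam l * V) := by
    rw [Finset.sum_congr huniv fun _ _ => rfl, Finset.sum_insert haM', Finset.sum_insert hlM,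
      hSa, hSl]
    have : ∑ i ∈ M, Ssum α (Finset.univ \ {i}) ((n : ℤ) - 1) lam * ξ i
        = C * (p * U - lam a * lam l * V) := by
      rw [hU, hV]
      simp only [Finset.mul_sum, ← Finset.sum_sub_distrib]
      refine Finset.sum_congr rfl fun i hi => ?_
      rw [hSi i hi, hzi i]
      ring
    rw [this]
    ring
  have hquad : ∑ j ∈ Finset.univ.erase a, Ssum α (Finset.univ \ {j}) ((n : ℤ) - 1) lam * ξ j ^ 2
      = C * ((lam a * t + 1) * ξ l ^ 2 + p * T - lam a * lam l * N) := by
    have hset : Finset.univ.erase a = insert l M := by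
      rw [huniv, Finset.erase_insert haM']
    rw [hset, Finset.sum_insert hlM, hSl]
    have : ∑ i ∈ M, Ssum α (Finset.univ \ {i}) ((n : ℤ) - 1) lam * ξ i ^ 2
        = C * (p * T - lam a * lam l * N) := by
      rw [hT, hN]
      simp only [Finset.mul_sum, ← Finset.sum_sub_distrib]
      refine Finset.sum_congr rfl fun i hi => ?_
      rw [hSi i hi, hzξ i hi]
      linear_combination (C * p * lam i * z i ^ 2
        - C * lam a * lam l * z i ^ 2 * (lam i * r i + 1)) * hrlam i hi
    rw [this]
    ring
  have hhess : ∑ p : Fin n, ∑ q ∈ Finset.univ.erase p,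
        Ssum α (Finset.univ \ {p, q}) ((n : ℤ) - 2) lam * ξ p * ξ q
      = C * (2 * ξ a * ξ l * t + 2 * ξ a * (lam l * (t * U - V) + U)
          + 2 * ξ l * (lam a * (t * U - V) + U)
          + lam a * lam l * (t * U ^ 2 - 2 * U * V + 2 * H - t * N)
          + (lam a + lam l) * (U ^ 2 - N)) := by
    obtain ⟨F, hF⟩ : ∃ F : Fin n → Fin n → ℝ,
      F = fun p q => Ssum α (Finset.univ \ {p, q}) ((n : ℤ) - 2) lam * ξ p * ξ q := ⟨_, rfl⟩
    have hFsymm : ∀ p q, F p q = F q p := fun p q => by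
      simp only [hF]
      rw [Finset.pair_comm]
      ring
    have hsplit : ∑ p : Fin n, ∑ q ∈ Finset.univ.erase p, F p q
        = ∑ p ∈ insert a (insert l M), ∑ q ∈ (insert a (insert l M)).erase p, F p q := by
      rw [← huniv]
    have hFai : ∑ i ∈ M, F a i = C * (ξ a * (lam l * (t * U - V) + U)) := by
      rw [hU, hV]
      simp only [Finset.mul_sum, ← Finset.sum_sub_distrib, ← Finset.sum_add_distrib]
      refine Finset.sum_congr rfl fun i hi => ?_
      simp only [hF]
      rw [hSai i hi, hzi i]
      ring
    have hFli : ∑ i ∈ M, F l i = C * (ξ l * (lam a * (t * U - V) + U)) := by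
      rw [hU, hV]
      simp only [Finset.mul_sum, ← Finset.sum_sub_distrib, ← Finset.sum_add_distrib]
      refine Finset.sum_congr rfl fun i hi => ?_
      simp only [hF]
      rw [hSli i hi, hzi i]
      ring
    have hFij : ∑ i ∈ M, ∑ j ∈ M.erase i, F i j
        = C * (lam a * lam l * (t * U ^ 2 - 2 * U * V + 2 * H - t * N)
          + (lam a + lam l) * (U ^ 2 - N)) := by
      rw [hU, hV, hH, hN, ← sum_sum_erase_bilinear, Finset.mul_sum]
      refine Finset.sum_congr rfl fun i hi => ?_
      rw [Finset.mul_sum]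
      refine Finset.sum_congr rfl fun j hj => ?_
      simp only [hF]
      rw [hSij i hi j hj, hzi i, hzi j]
      ring
    have hFal : F a l = C * t * ξ a * ξ l := by simp only [hF]; rw [hSal]
    have hsum : ∑ p : Fin n, ∑ q ∈ Finset.univ.erase p,
        Ssum α (Finset.univ \ {p, q}) ((n : ℤ) - 2) lam * ξ p * ξ q
        = ∑ p : Fin n, ∑ q ∈ Finset.univ.erase p, F p q := by rw [hF]
    rw [hsum, hsplit, sum_sum_erase_insert F hFsymm haM', sum_sum_erase_insert F hFsymm hlM,
      Finset.sum_insert hlM, hFai, hFli, hFij, hFal]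
    ring
  have hVH : V ^ 2 ≤ t * H := by
    have h : V ^ 2 ≤ (∑ i ∈ M, r i) * H := by
      rw [hV, hH]
      exact Finset.sum_sq_le_sum_mul_sum_of_sq_le_mul M (fun i hi => (hrpos i hi).le)
        (fun i hi => mul_nonneg (hrpos i hi).le (sq_nonneg _)) fun i _ => le_of_eq (by ring)
    have hH0 : 0 ≤ H := by
      rw [hH]; exact Finset.sum_nonneg fun i hi => mul_nonneg (hrpos i hi).le (sq_nonneg _)
    exact h.trans (mul_le_mul_of_nonneg_right hRt hH0)
  have hUT : U ^ 2 ≤ t * T := by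
    have h : U ^ 2 ≤ (∑ i ∈ M, r i) * T := by
      rw [hU, hT]
      exact Finset.sum_sq_le_sum_mul_sum_of_sq_le_mul M (fun i hi => (hrpos i hi).le)
        (fun i hi => mul_nonneg (hpos i hi).le (sq_nonneg _)) fun i hi =>
          le_of_eq (by linear_combination (-z i ^ 2) * hrlam i hi)
    have hT0 : 0 ≤ T := by
      rw [hT]; exact Finset.sum_nonneg fun i hi => mul_nonneg (hpos i hi).le (sq_nonneg _)
    exact h.trans (mul_le_mul_of_nonneg_right hRt hT0)
  have hlog : 0 ≤ V ^ 2 + t ^ 2 * N - 2 * t * H := by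
    rw [hV, hN, hH]
    exact sq_sum_add_nonneg M r z hrpos hRt
  have hb : (lam l * U + ξ l) ^ 2
      ≤ κ * ((lam a * t + 1) * ξ l ^ 2 + p * T - lam a * lam l * N) := by
    have hW : p * T - lam a * lam l * N = ∑ i ∈ M, (p * lam i - lam a * lam l) * z i ^ 2 := by
      rw [hT, hN]
      simp only [Finset.mul_sum, ← Finset.sum_sub_distrib]
      exact Finset.sum_congr rfl fun i _ => by ring
    have hW0 : 0 ≤ p * T - lam a * lam l * N := by
      rw [hW]; exact Finset.sum_nonneg fun i hi => mul_nonneg (hci i hi).le (sq_nonneg _)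
    have hU2 : U ^ 2 ≤ (∑ i ∈ M, (p * lam i - lam a * lam l)⁻¹)
        * (p * T - lam a * lam l * N) := by
      rw [hU, hW]
      exact Finset.sum_sq_le_sum_mul_sum_of_sq_le_mul M (fun i hi => (inv_pos.mpr (hci i hi)).le)
        (fun i hi => mul_nonneg (hci i hi).le (sq_nonneg _)) fun i hi =>
          le_of_eq (by rw [inv_mul_cancel_left₀ (hci i hi).ne'])
    rw [hκ, add_sub_assoc]
    exact add_sq_le_of_sq_le_mul hat hinv hW0 hU2
  have hmain := mul_nonneg hC0.le (reduced_form_nonneg (x := ξ a) ha ht0 hw hw0 hp hp0 hVH hUT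
    hlog hε hκ0 hb hk)
  rw [hgrad, hquad, hhess, hSa, ge_iff_le]
  refine hmain.trans_eq ?_
  field_simp

end

/-- Lemma 3.3: the concavity inequality for `S_n`: for ordered `λ ∈ Γ̃_n` and
every `ε > 0` there exists `K > 0` such that for all `ξ`,
`λ_1 (K (Σ_j S_n^{jj} ξ_j)² - Σ_{p≠q} S_n^{pp,qq} ξ_p ξ_q) - S_n^{11} ξ_1²
  + (1+ε) Σ_{j>1} S_n^{jj} ξ_j² ≥ 0`. -/
theorem concavity_inequality_Sn {n : ℕ} (hn : 3 ≤ n) (α : ℝ) (hα : 0 ≤ α)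
    (lam : Fin n → ℝ) (hlam : lam ∈ GammaTilde n n α) (hord : Antitone lam)
    (ε : ℝ) (hε : 0 < ε) :
    ∃ K : ℝ, 0 < K ∧ ∀ ξ : Fin n → ℝ,
      lam ⟨0, by omega⟩
          * (K * (∑ j : Fin n, Ssum α (Finset.univ \ {j}) ((n : ℤ) - 1) lam * ξ j) ^ 2
              - ∑ p : Fin n, ∑ q ∈ Finset.univ.erase p,
                  Ssum α (Finset.univ \ {p, q}) ((n : ℤ) - 2) lam * ξ p * ξ q)
        - Ssum α (Finset.univ \ {(⟨0, by omega⟩ : Fin n)}) ((n : ℤ) - 1) lam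
            * (ξ ⟨0, by omega⟩) ^ 2
        + (1 + ε) * ∑ j ∈ Finset.univ.erase (⟨0, by omega⟩ : Fin n),
            Ssum α (Finset.univ \ {j}) ((n : ℤ) - 1) lam * ξ j ^ 2
      ≥ 0 := by
  have hmid : ∀ i : Fin n, i.val + 1 < n → 0 < lam i := fun i hi =>
    pos_of_lt_last hlam.1 hord hi
  have hal : (⟨0, by omega⟩ : Fin n) ≠ ⟨n - 1, by omega⟩ := by
    simp only [ne_eq, Fin.mk.injEq]; omega
  refine concavity_inequality_of_pos α hα lam (l := ⟨n - 1, by omega⟩)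
    (M := (Finset.univ.erase ⟨0, by omega⟩).erase ⟨n - 1, by omega⟩) hal (by simp) (by simp)
    ?_ ⟨⟨1, by omega⟩, ?_⟩ ?_ (hmid _ (by simp only; omega)) hlam.2 ε hε
  · ext i
    simp only [Finset.mem_insert, Finset.mem_erase, Finset.mem_univ]
    tauto
  · refine Finset.mem_erase.mpr ⟨?_, Finset.mem_erase.mpr ⟨?_, Finset.mem_univ _⟩⟩ <;>
      simp only [ne_eq, Fin.mk.injEq] <;> omega
  · intro i hi
    simp only [Finset.mem_erase, Finset.mem_univ, ne_eq, Fin.ext_iff] at hi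
    exact hmid i (by omega)
end
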